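/- Suppose the vectors Δx, Δzxl, Δzxu : Fin n → ℝ and Δs, Δy, Δzsl, Δzsu : Fin m → ℝ satisfy the full lifted KKT system (equations (1)–(7) as in the context). Then Δx satisfies the condensed KKT system M_cond.mulVec Δx = qx + Aᵀ.mulVec (C.mulVec qs + D.mulVec qy), where qx := px + (fun i => pzxl i / dxl i) - (fun i => pzxu i / dxu i), qs := ps + (fun j => pzsl j / dsl j) - (fun j => pzsu j / dsu j), and qy := py. -/

import Mathlib

open Matrix

/-- `C := (δc • Σs + (1 + δc*δw) • 1)⁻¹` from the condensed-space IPM. -/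
noncomputable def Cmat (m : ℕ) (δw δc : ℝ) (σs : Fin m → ℝ) : Matrix (Fin m) (Fin m) ℝ :=
  (δc • Matrix.diagonal σs + (1 + δc * δw) • (1 : Matrix (Fin m) (Fin m) ℝ))⁻¹

/-- `D := (Σs + δw • 1) * C`. -/
noncomputable def Dmat (m : ℕ) (δw δc : ℝ) (σs : Fin m → ℝ) : Matrix (Fin m) (Fin m) ℝ :=
  (Matrix.diagonal σs + δw • (1 : Matrix (Fin m) (Fin m) ℝ)) * Cmat m δw δc σs

/-- The condensed KKT matrix `M_cond := W + δw • 1 + Σx + Aᵀ * D * A`. -/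
noncomputable def Mcond (n m : ℕ) (W : Matrix (Fin n) (Fin n) ℝ)
    (A : Matrix (Fin m) (Fin n) ℝ) (δw δc : ℝ) (σx : Fin n → ℝ) (σs : Fin m → ℝ) :
    Matrix (Fin n) (Fin n) ℝ :=
  W + δw • (1 : Matrix (Fin n) (Fin n) ℝ) + Matrix.diagonal σx + Aᵀ * Dmat m δw δc σs * A

/-- Eliminating the multipliers of a lower and an upper bound from their linearized
complementarity equations. -/
theorem bound_multiplier_elim {dl du zl zu x wl wu pl pu : ℝ} (hdl : dl ≠ 0) (hdu : du ≠ 0)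
    (hl : zl * x + dl * wl = pl) (hu : -(zu * x) + du * wu = pu) :
    wu - wl = (zl / dl + zu / du) * x - pl / dl + pu / du := by
  subst hl hu
  field_simp
  ring

theorem Cmat_eq_diagonal {m : ℕ} {δw δc : ℝ} {σs : Fin m → ℝ}
    (h : ∀ j, δc * σs j + (1 + δc * δw) ≠ 0) :
    Cmat m δw δc σs = diagonal fun j => (δc * σs j + (1 + δc * δw))⁻¹ := by
  refine Matrix.inv_eq_right_inv ?_
  rw [← diagonal_one, ← diagonal_smul, ← diagonal_smul, diagonal_add, diagonal_mul_diagonal]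
  congr 1
  ext j
  simpa using mul_inv_cancel₀ (h j)

theorem Dmat_eq_diagonal {m : ℕ} {δw δc : ℝ} {σs : Fin m → ℝ}
    (h : ∀ j, δc * σs j + (1 + δc * δw) ≠ 0) :
    Dmat m δw δc σs =
      diagonal fun j => (σs j + δw) * (δc * σs j + (1 + δc * δw))⁻¹ := by
  rw [Dmat, Cmat_eq_diagonal h, ← diagonal_one, ← diagonal_smul, diagonal_add,
    diagonal_mul_diagonal]
  simp

theorem stmt_9 (n m : ℕ) (W : Matrix (Fin n) (Fin n) ℝ) (hW : W.IsSymm)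
    (A : Matrix (Fin m) (Fin n) ℝ) (δw δc : ℝ) (hδw : 0 < δw) (hδc : 0 < δc)
    (dxl dxu zxl zxu : Fin n → ℝ)
    (hdxl : ∀ i, 0 < dxl i) (hdxu : ∀ i, 0 < dxu i)
    (hzxl : ∀ i, 0 < zxl i) (hzxu : ∀ i, 0 < zxu i)
    (dsl dsu zsl zsu : Fin m → ℝ)
    (hdsl : ∀ j, 0 < dsl j) (hdsu : ∀ j, 0 < dsu j)
    (hzsl : ∀ j, 0 < zsl j) (hzsu : ∀ j, 0 < zsu j)
    (px pzxl pzxu : Fin n → ℝ) (ps py pzsl pzsu : Fin m → ℝ)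
    (Δx Δzxl Δzxu : Fin n → ℝ) (Δs Δy Δzsl Δzsu : Fin m → ℝ)
    (h1 : (W + δw • (1 : Matrix (Fin n) (Fin n) ℝ)).mulVec Δx
            + Aᵀ.mulVec Δy - Δzxl + Δzxu = px)
    (h2 : δw • Δs - Δy - Δzsl + Δzsu = ps)
    (h3 : A.mulVec Δx - Δs - δc • Δy = py)
    (h4 : (Matrix.diagonal zxl).mulVec Δx + (Matrix.diagonal dxl).mulVec Δzxl = pzxl)
    (h5 : -(Matrix.diagonal zxu).mulVec Δx + (Matrix.diagonal dxu).mulVec Δzxu = pzxu)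
    (h6 : (Matrix.diagonal zsl).mulVec Δs + (Matrix.diagonal dsl).mulVec Δzsl = pzsl)
    (h7 : -(Matrix.diagonal zsu).mulVec Δs + (Matrix.diagonal dsu).mulVec Δzsu = pzsu) :
    (Mcond n m W A δw δc (fun i => zxl i / dxl i + zxu i / dxu i)
        (fun j => zsl j / dsl j + zsu j / dsu j)).mulVec Δx
      = (px + (fun i => pzxl i / dxl i) - (fun i => pzxu i / dxu i))
        + Aᵀ.mulVec
          ((Cmat m δw δc (fun j => zsl j / dsl j + zsu j / dsu j)).mulVec
              (ps + (fun j => pzsl j / dsl j) - (fun j => pzsu j / dsu j))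
            + (Dmat m δw δc (fun j => zsl j / dsl j + zsu j / dsu j)).mulVec py) := by
  have hden : ∀ j, δc * (zsl j / dsl j + zsu j / dsu j) + (1 + δc * δw) ≠ 0 := fun j => by
    have := hdsl j; have := hdsu j; have := hzsl j; have := hzsu j
    positivity
  have hx : Δzxu - Δzxl = (diagonal fun i => zxl i / dxl i + zxu i / dxu i) *ᵥ Δx
      - (fun i => pzxl i / dxl i) + fun i => pzxu i / dxu i := by
    ext i
    have hl := congrFun h4 i
    have hu := congrFun h5 i
    simp only [Pi.add_apply, Pi.sub_apply, Pi.neg_apply, mulVec_diagonal] at hl hu ⊢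
    exact bound_multiplier_elim (hdxl i).ne' (hdxu i).ne' hl hu
  have hy : Δy = Dmat m δw δc (fun j => zsl j / dsl j + zsu j / dsu j) *ᵥ (A *ᵥ Δx)
      - (Cmat m δw δc (fun j => zsl j / dsl j + zsu j / dsu j) *ᵥ
          (ps + (fun j => pzsl j / dsl j) - (fun j => pzsu j / dsu j))
        + Dmat m δw δc (fun j => zsl j / dsl j + zsu j / dsu j) *ᵥ py) := by
    rw [Cmat_eq_diagonal hden, Dmat_eq_diagonal hden]
    ext j
    have hs := congrFun h2 j
    have hc := congrFun h3 j
    have hl := congrFun h6 j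
    have hu := congrFun h7 j
    simp only [Pi.add_apply, Pi.sub_apply, Pi.neg_apply, Pi.smul_apply, smul_eq_mul,
      mulVec_diagonal] at hs hc hl hu ⊢
    have hz := bound_multiplier_elim (hdsl j).ne' (hdsu j).ne' hl hu
    have hj := hden j
    generalize zsl j / dsl j + zsu j / dsu j = σ at hz hj ⊢
    generalize pzsl j / dsl j = a at hz ⊢
    generalize pzsu j / dsu j = b at hz ⊢
    have hyj : Δy j * (δc * σ + (1 + δc * δw)) =
        (σ + δw) * ((A *ᵥ Δx) j - py j) - (ps j + a - b) := by
      linear_combination -(σ + δw) * hc - hs + hz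
    rw [(eq_mul_inv_iff_mul_eq₀ hj).2 hyj]
    ring
  rw [Mcond, add_mulVec, add_mulVec, ← mulVec_mulVec, ← mulVec_mulVec]
  rw [eq_sub_iff_add_eq] at hy
  rw [← hy, mulVec_add, ← h1, add_sub_assoc]
  linear_combination -hx
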